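/- Let q ∈ ℂ[b,c,d,e] be a quadratic form such that for every (s,t) ∈ ℂ² the quadratic form s²·bc + t²·de + st·q in the four variables b,c,d,e has rank at most 2 (i.e. its symmetric 4×4 matrix has all 3×3 minors equal to zero). Then there exists μ ∈ ℂ, μ ≠ 0, such that q = μ·be + μ⁻¹·cd or q = μ·bd + μ⁻¹·ce (the second case being the first after exchanging the variables d and e). -/

import Mathlib

open MvPolynomial

/-- The space of polynomials in the five variables `a,b,c,d,e` (indexed `0,…,4`). -/
abbrev Quin : Type := MvPolynomial (Fin 5) ℂ

/-- `m` is (the exponent vector of) a quadratic monomial. -/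
def QuadMon (m : Fin 5 →₀ ℕ) : Prop := (m.sum fun _ n => n) = 2

/-- A net of quadrics: a 3-dimensional space of quadratic forms. -/
def IsNet (Λ : Submodule ℂ Quin) : Prop :=
  Module.finrank ℂ Λ = 3 ∧ ∀ Q ∈ Λ, MvPolynomial.IsHomogeneous Q 2

/-- The `ρ`-weight of a monomial. -/
def wt (ρ : Fin 5 → ℤ) (m : Fin 5 →₀ ℕ) : ℤ := ∑ i, (m i : ℤ) * ρ i

/-- `Λ` is semistable with respect to the weight vector `ρ`: there are three distinct
quadratic monomials with total `ρ`-weight `≥ 0` such that the corresponding coefficient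
map `Λ → ℂ³` is bijective. -/
def SemistableWrt (Λ : Submodule ℂ Quin) (ρ : Fin 5 → ℤ) : Prop :=
  ∃ m1 m2 m3 : Fin 5 →₀ ℕ, m1 ≠ m2 ∧ m1 ≠ m3 ∧ m2 ≠ m3 ∧
    QuadMon m1 ∧ QuadMon m2 ∧ QuadMon m3 ∧
    0 ≤ wt ρ m1 + wt ρ m2 + wt ρ m3 ∧
    Function.Bijective (fun Q : Λ =>
      (![MvPolynomial.coeff m1 (Q : Quin), MvPolynomial.coeff m2 (Q : Quin),
         MvPolynomial.coeff m3 (Q : Quin)] : Fin 3 → ℂ))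

/-- The twelve distinguished weight vectors `ρ1,…,ρ12`. -/
def rho : Fin 12 → Fin 5 → ℤ :=
  ![![1,1,1,1,-4], ![2,2,2,-3,-3], ![3,3,-2,-2,-2], ![4,-1,-1,-1,-1],
    ![3,3,3,-2,-7], ![4,4,-1,-1,-6], ![9,4,-1,-6,-6], ![7,2,2,-3,-8],
    ![12,7,2,-8,-13], ![9,4,-1,-1,-11], ![14,4,-1,-6,-11], ![13,8,3,-7,-17]]

/-- A normalized weight vector: nonincreasing, sums to zero and not identically zero. -/
def IsNormalized (ρ : Fin 5 → ℤ) : Prop :=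
  (∀ i j : Fin 5, i ≤ j → ρ j ≤ ρ i) ∧ (∑ i, ρ i) = 0 ∧ ρ ≠ 0

/-- Linear substitution of variables by the matrix `g`, as a linear map on polynomials. -/
noncomputable def substMap (g : Matrix (Fin 5) (Fin 5) ℂ) : Quin →ₗ[ℂ] Quin :=
  (MvPolynomial.aeval fun i => ∑ j, MvPolynomial.C (g i j) * MvPolynomial.X j).toLinearMap

/-- Semistability of a net (Hilbert–Mumford criterion for `SL(5)`). -/
def Semistable (Λ : Submodule ℂ Quin) : Prop :=
  ∀ (g : Matrix.GeneralLinearGroup (Fin 5) ℂ) (ρ : Fin 5 → ℤ), IsNormalized ρ →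
    SemistableWrt (Submodule.map (substMap (g : Matrix (Fin 5) (Fin 5) ℂ)) Λ) ρ

/-- The symmetric matrix of a quadratic form. -/
noncomputable def quadMatrix (Q : Quin) : Matrix (Fin 5) (Fin 5) ℂ :=
  Matrix.of fun i j =>
    if i = j then MvPolynomial.coeff (Finsupp.single i 2) Q
    else (1/2) * MvPolynomial.coeff (Finsupp.single i 1 + Finsupp.single j 1) Q

/-- The discriminant quintic `det (x·A1 + y·A2 + z·A3)` of a net with basis `Q1,Q2,Q3`. -/
noncomputable def netDisc (Q1 Q2 Q3 : Quin) : MvPolynomial (Fin 3) ℂ :=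
  Matrix.det (Matrix.of fun i j : Fin 5 =>
    MvPolynomial.C (quadMatrix Q1 i j) * MvPolynomial.X 0 +
    MvPolynomial.C (quadMatrix Q2 i j) * MvPolynomial.X 1 +
    MvPolynomial.C (quadMatrix Q3 i j) * MvPolynomial.X 2)

/-- The net lies on a smooth quartic del Pezzo surface. -/
def OnSmoothDelPezzo (Λ : Submodule ℂ Quin) : Prop :=
  ∃ P1 P2 : Quin, P1 ∈ Λ ∧ P2 ∈ Λ ∧ LinearIndependent ℂ ![P1, P2] ∧
    ∀ v : Fin 5 → ℂ, v ≠ 0 → MvPolynomial.eval v P1 = 0 → MvPolynomial.eval v P2 = 0 →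
      LinearIndependent ℂ
        ![fun i => MvPolynomial.eval v (MvPolynomial.pderiv i P1),
          fun i => MvPolynomial.eval v (MvPolynomial.pderiv i P2)]

/-- The symmetric matrix of a quadratic form in the four variables `b,c,d,e`
(indexed `0,…,3`). -/
noncomputable def quadMatrix4 (Q : MvPolynomial (Fin 4) ℂ) : Matrix (Fin 4) (Fin 4) ℂ :=
  Matrix.of fun i j =>
    if i = j then MvPolynomial.coeff (Finsupp.single i 2) Q
    else (1/2) * MvPolynomial.coeff (Finsupp.single i 1 + Finsupp.single j 1) Q

theorem Matrix.det_submatrix_eq_zero_of_rank_lt {K m n k : Type*} [Field K] [Fintype m] [Fintype n]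
    [Fintype k] [DecidableEq k] (M : Matrix m n K) (f : k → m) (g : k → n)
    (h : M.rank < Fintype.card k) : (M.submatrix f g).det = 0 := by
  by_contra hdet
  have h1 := Matrix.rank_of_isUnit (M.submatrix f g)
    ((Matrix.isUnit_iff_isUnit_det _).2 (isUnit_iff_ne_zero.2 hdet))
  have h2 := M.rank_submatrix_le f g
  omega

theorem Finsupp.exists_single_add_single_of_degree_eq_two {σ : Type*} {m : σ →₀ ℕ}
    (hm : m.degree = 2) : ∃ i j, m = Finsupp.single i 1 + Finsupp.single j 1 := by
  classical
  have hcard : (Finsupp.toMultiset m).card = 2 := by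
    rw [Finsupp.card_toMultiset]; exact hm
  obtain ⟨i, j, hij⟩ := Multiset.card_eq_two.1 hcard
  refine ⟨i, j, Multiset.toFinsupp.symm.injective ?_⟩
  simp [Multiset.toFinsupp_symm_apply, hij, Multiset.singleton_add]

theorem eq_of_quadMatrix4_eq {P Q : MvPolynomial (Fin 4) ℂ} (hP : P.IsHomogeneous 2)
    (hQ : Q.IsHomogeneous 2) (h : quadMatrix4 P = quadMatrix4 Q) : P = Q := by
  ext m
  by_cases hm : m.degree = 2
  · obtain ⟨i, j, rfl⟩ := Finsupp.exists_single_add_single_of_degree_eq_two hm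
    have hij := congrFun (congrFun h i) j
    by_cases e : i = j
    · subst e
      simpa [quadMatrix4, ← Finsupp.single_add] using hij
    · simpa [quadMatrix4, e] using hij
  · rw [hP.coeff_eq_zero hm, hQ.coeff_eq_zero hm]

theorem quadMatrix4_add (P Q : MvPolynomial (Fin 4) ℂ) :
    quadMatrix4 (P + Q) = quadMatrix4 P + quadMatrix4 Q := by
  ext i j
  by_cases e : i = j <;> simp [quadMatrix4, e, mul_add]

theorem quadMatrix4_C_mul (r : ℂ) (P : MvPolynomial (Fin 4) ℂ) :
    quadMatrix4 (C r * P) = r • quadMatrix4 P := by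
  ext i j
  by_cases e : i = j <;> simp [quadMatrix4, e, coeff_C_mul, mul_left_comm]

theorem quadMatrix4_X_mul_X {k l : Fin 4} (hkl : k ≠ l) :
    quadMatrix4 (X k * X l) =
      Matrix.of fun i j => if i = k ∧ j = l ∨ i = l ∧ j = k then 1 / 2 else 0 := by
  have hX : (X k * X l : MvPolynomial (Fin 4) ℂ) =
      monomial (Finsupp.single k 1 + Finsupp.single l 1) 1 := by
    simp [X, monomial_mul]
  ext i j
  by_cases e : i = j
  · subst e
    have h2 : Finsupp.single i 2 = Finsupp.single i 1 + Finsupp.single i 1 := by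
      rw [← Finsupp.single_add]
    simp only [quadMatrix4, hX, coeff_monomial, Matrix.of_apply, h2]
    rw [if_pos trivial, if_neg, if_neg]
    · grind
    · rw [Finsupp.single_add_single_eq_single_add_single one_ne_zero one_ne_zero]
      grind
  · simp only [quadMatrix4, hX, coeff_monomial, Matrix.of_apply, e, if_false,
      Finsupp.single_add_single_eq_single_add_single one_ne_zero one_ne_zero]
    grind

theorem quadMatrix4_symm (P : MvPolynomial (Fin 4) ℂ) (i j : Fin 4) :
    quadMatrix4 P i j = quadMatrix4 P j i := by
  simp [quadMatrix4, eq_comm, add_comm]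
  by_cases e : i = j <;> simp [e]

/-- If `s²·bc + t²·de + st·q` has rank at most `2` for all `(s,t)`, then
`q = μ·be + μ⁻¹·cd` or `q = μ·bd + μ⁻¹·ce` for some nonzero `μ`. -/
theorem rank_two_pencil_claim (q : MvPolynomial (Fin 4) ℂ) (hq : q.IsHomogeneous 2)
    (hrk : ∀ s t : ℂ,
      (quadMatrix4 (MvPolynomial.C (s ^ 2) * (MvPolynomial.X 0 * MvPolynomial.X 1) +
        MvPolynomial.C (t ^ 2) * (MvPolynomial.X 2 * MvPolynomial.X 3) +
        MvPolynomial.C (s * t) * q)).rank ≤ 2) :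
    ∃ μ : ℂ, μ ≠ 0 ∧
      (q = MvPolynomial.C μ * (MvPolynomial.X 0 * MvPolynomial.X 3) +
            MvPolynomial.C μ⁻¹ * (MvPolynomial.X 1 * MvPolynomial.X 2) ∨
       q = MvPolynomial.C μ * (MvPolynomial.X 0 * MvPolynomial.X 2) +
            MvPolynomial.C μ⁻¹ * (MvPolynomial.X 1 * MvPolynomial.X 3)) := by
  obtain ⟨r, hr⟩ : ∃ r, r = quadMatrix4 q := ⟨_, rfl⟩
  have hsymm (i j) : r i j = r j i := hr ▸ quadMatrix4_symm q i j
  have hdet (f g : Fin 3 → Fin 4) (u : ℂ) : (((u ^ 2) • quadMatrix4 (X 0 * X 1) +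
        (1 : ℂ) • quadMatrix4 (X 2 * X 3) + u • r).submatrix f g).det = 0 := by
    refine Matrix.det_submatrix_eq_zero_of_rank_lt _ f g ?_
    have := hrk u 1
    simp only [quadMatrix4_add, quadMatrix4_C_mul, one_pow, mul_one, ← hr] at this
    simpa using Nat.lt_succ_of_le this
  have hminor (f g : Fin 3 → Fin 4) := (⟨hdet f g 1, hdet f g (-1), hdet f g 2, hdet f g (-2)⟩ :
    _ ∧ _ ∧ _ ∧ _)
  simp only [Matrix.det_fin_three, quadMatrix4_X_mul_X (show (0 : Fin 4) ≠ 1 by decide),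
    quadMatrix4_X_mul_X (show (2 : Fin 4) ≠ 3 by decide)] at hminor
  obtain ⟨a1, a2, a3, a4⟩ := hminor ![0, 1, 2] ![0, 1, 2]
  obtain ⟨b1, b2, b3, b4⟩ := hminor ![0, 1, 3] ![0, 1, 3]
  obtain ⟨c1, c2, c3, c4⟩ := hminor ![0, 2, 3] ![0, 2, 3]
  obtain ⟨d1, d2, d3, d4⟩ := hminor ![1, 2, 3] ![1, 2, 3]
  obtain ⟨e1, e2, e3, e4⟩ := hminor ![0, 1, 2] ![0, 1, 3]
  obtain ⟨f1, f2, f3, f4⟩ := hminor ![0, 2, 3] ![1, 2, 3]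
  simp [hsymm 1 0, hsymm 2 0, hsymm 3 0, hsymm 2 1, hsymm 3 1, hsymm 3 2]
    at a1 a2 a3 a4 b1 b2 b3 b4 c1 c2 c3 c4 d1 d2 d3 d4 e1 e2 e3 e4 f1 f2 f3 f4
  have h22 : r 2 2 = 0 := by
    linear_combination (-4) * (((a3 - a4) / 4 - 2 * (a1 - a2)) / 12)
  have h33 : r 3 3 = 0 := by
    linear_combination (-4) * (((b3 - b4) / 4 - 2 * (b1 - b2)) / 12)
  have h00 : r 0 0 = 0 := by
    linear_combination (-4) * ((8 * (c1 - c2) - (c3 - c4)) / 12)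
  have h11 : r 1 1 = 0 := by
    linear_combination (-4) * ((8 * (d1 - d2) - (d3 - d4)) / 12)
  have h23 : r 2 3 = 0 := by
    linear_combination (-4) * (((e3 - e4) / 4 - 2 * (e1 - e2)) / 12)
  have h01 : r 0 1 = 0 := by
    linear_combination (-4) * ((4 * (f1 - f2) - (f3 - f4) / 2) / 6)
  have h02_12 : r 0 2 * r 1 2 = 0 := by
    linear_combination ((a3 + a4) / 4 - (a1 + a2)) / 6 + r 0 1 * h22
  have h03_13 : r 0 3 * r 1 3 = 0 := by
    linear_combination ((b3 + b4) / 4 - (b1 + b2)) / 6 + r 0 1 * h33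
  have h02_03 : r 0 2 * r 0 3 = 0 := by
    linear_combination (c1 + c2) / 2 + r 2 3 * h00
  have hsum : r 0 3 * r 1 2 + r 0 2 * r 1 3 = 1 / 4 := by
    linear_combination 2 * (((e3 + e4) / 4 - (e1 + e2)) / 6) + 2 * r 0 1 * h23
  have hom (k l m n : Fin 4) (x y : ℂ) :
      (C x * (X k * X l) + C y * (X m * X n)).IsHomogeneous 2 := by
    have hX (k l : Fin 4) : (X k * X l : MvPolynomial (Fin 4) ℂ).IsHomogeneous 2 :=
      (isHomogeneous_X ℂ k).mul (isHomogeneous_X ℂ l)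
    exact ((hX k l).C_mul x).add ((hX m n).C_mul y)
  by_cases h02 : r 0 2 = 0
  · have h : r 0 3 * r 1 2 = 1 / 4 := by simpa [h02] using hsum
    have h03 : r 0 3 ≠ 0 := by rintro h0; simp [h0] at h
    have h13 : r 1 3 = 0 := by simpa [h03] using h03_13
    have hinv : (2 * r 0 3)⁻¹ = 2 * r 1 2 :=
      inv_eq_of_mul_eq_one_right (by linear_combination 4 * h)
    refine ⟨2 * r 0 3, by simpa using h03, Or.inl (eq_of_quadMatrix4_eq hq (hom ..) ?_)⟩
    rw [quadMatrix4_add, quadMatrix4_C_mul, quadMatrix4_C_mul, quadMatrix4_X_mul_X (by decide),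
      quadMatrix4_X_mul_X (by decide), hinv, ← hr]
    ext i j
    fin_cases i <;> fin_cases j <;>
      simp [h00, h11, h22, h33, h01, h23, h02, h13, hsymm 1 0, hsymm 2 0, hsymm 3 0, hsymm 2 1,
        hsymm 3 1, hsymm 3 2, mul_comm (2 : ℂ)]
  · have h03 : r 0 3 = 0 := by simpa [h02] using h02_03
    have h12 : r 1 2 = 0 := by simpa [h02] using h02_12
    have h : r 0 2 * r 1 3 = 1 / 4 := by simpa [h03] using hsum
    have hinv : (2 * r 0 2)⁻¹ = 2 * r 1 3 :=
      inv_eq_of_mul_eq_one_right (by linear_combination 4 * h)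
    refine ⟨2 * r 0 2, by simpa using h02, Or.inr (eq_of_quadMatrix4_eq hq (hom ..) ?_)⟩
    rw [quadMatrix4_add, quadMatrix4_C_mul, quadMatrix4_C_mul, quadMatrix4_X_mul_X (by decide),
      quadMatrix4_X_mul_X (by decide), hinv, ← hr]
    ext i j
    fin_cases i <;> fin_cases j <;>
      simp [h00, h11, h22, h33, h01, h23, h03, h12, hsymm 1 0, hsymm 2 0, hsymm 3 0, hsymm 2 1,
        hsymm 3 1, hsymm 3 2, mul_comm (2 : ℂ)]
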